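/- Let 𝒰 be a finite set and let S : Set 𝒰 → Σ be a composable sketching map with unique cores. If σ₁, σ₂ are in the image of S and MaxSet(σ₂) ⊆ MaxSet(σ₁), then core(σ₁) ∩ MaxSet(σ₂) ⊆ core(σ₂). -/

import Mathlib

/-- A sketching map `S` on ground set `𝒰` is *composable* if there is a binary
operation `op` on sketch values with `S (A ∪ B) = op (S A) (S B)` for all `A B`. -/
def Composable {𝒰 T : Type*} (S : Set 𝒰 → T) : Prop :=
  ∃ op : T → T → T, ∀ A B : Set 𝒰, S (A ∪ B) = op (S A) (S B)

/-- `C` is a *core* of the sketch value `σ`: `S C = σ` and no proper subset of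
`C` has sketch `σ`. -/
def IsCore {𝒰 T : Type*} (S : Set 𝒰 → T) (σ : T) (C : Set 𝒰) : Prop :=
  S C = σ ∧ ∀ C' : Set 𝒰, C' ⊂ C → S C' ≠ σ

/-- `MaxSet S σ` is the union of all subsets whose sketch equals `σ`. -/
def MaxSet {𝒰 T : Type*} (S : Set 𝒰 → T) (σ : T) : Set 𝒰 :=
  ⋃₀ {A : Set 𝒰 | S A = σ}

/-- For a composable sketching map, replacing a part of a union by a set with the same sketch
does not change the sketch. -/
theorem Composable.union_congr_right {𝒰 T : Type*} {S : Set 𝒰 → T} (hS : Composable S)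
    {B C : Set 𝒰} (h : S B = S C) (A : Set 𝒰) : S (A ∪ B) = S (A ∪ C) := by
  obtain ⟨op, hop⟩ := hS
  rw [hop, hop, h]

/-- The maximal set of a sketch value in the image of a composable map has that sketch value. -/
theorem Composable.apply_maxSet {𝒰 T : Type*} [Finite 𝒰] {S : Set 𝒰 → T} (hS : Composable S)
    {σ : T} (hσ : σ ∈ Set.range S) : S (MaxSet S σ) = σ := by
  obtain ⟨M, hM⟩ := (Set.toFinite {A : Set 𝒰 | S A = σ}).exists_maximal hσ
  have hMσ : S M = σ := hM.prop
  have hle : ∀ B, S B = σ → B ⊆ M := fun B hB ↦ by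
    have hMB : S (M ∪ B) = σ := by
      rw [hS.union_congr_right (hB.trans hMσ.symm), Set.union_self, hMσ]
    exact Set.subset_union_right.trans (hM.le_of_ge hMB Set.subset_union_left)
  have hMax : MaxSet S σ = M :=
    Set.Subset.antisymm (Set.sUnion_subset hle) (Set.subset_sUnion_of_mem hMσ)
  rw [hMax, hMσ]

/-- Over a finite ground set, every set contains a core of its sketch value. -/
theorem exists_isCore_subset {𝒰 T : Type*} [Finite 𝒰] (S : Set 𝒰 → T) (A : Set 𝒰) :
    ∃ C ⊆ A, IsCore S (S A) C := by
  obtain ⟨C, hCA, hC⟩ := (Set.toFinite {B : Set 𝒰 | S B = S A}).exists_le_minimal rfl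
  exact ⟨C, hCA, hC.prop, fun B hBC hB ↦ hBC.2 (hC.le_of_le hB hBC.1)⟩

/-- Inheritance for unique cores: if `MaxSet σ₂ ⊆ MaxSet σ₁` then
`core σ₁ ∩ MaxSet σ₂ ⊆ core σ₂`.  Here `core` is a function assigning to
each sketch value in the image of `S` its unique core. -/
theorem stmt5 {𝒰 T : Type*} [Fintype 𝒰] (S : Set 𝒰 → T) (hS : Composable S)
    (core : T → Set 𝒰)
    (hcore : ∀ σ ∈ Set.range S,
      IsCore S σ (core σ) ∧ ∀ C : Set 𝒰, IsCore S σ C → C = core σ)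
    (σ₁ σ₂ : T) (h₁ : σ₁ ∈ Set.range S) (h₂ : σ₂ ∈ Set.range S)
    (hsub : MaxSet S σ₂ ⊆ MaxSet S σ₁) :
    core σ₁ ∩ MaxSet S σ₂ ⊆ core σ₂ := by
  intro x ⟨hx₁, hx₂⟩
  have hσ₂ : S (core σ₂) = S (MaxSet S σ₂) :=
    (hcore σ₂ h₂).1.1.trans (hS.apply_maxSet h₂).symm
  have hσ₁ : S (MaxSet S σ₁ \ MaxSet S σ₂ ∪ core σ₂) = σ₁ := by
    rw [hS.union_congr_right hσ₂, Set.sdiff_union_of_subset hsub, hS.apply_maxSet h₁]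
  obtain ⟨C, hCsub, hC⟩ := exists_isCore_subset S (MaxSet S σ₁ \ MaxSet S σ₂ ∪ core σ₂)
  rw [hσ₁] at hC
  rw [← (hcore σ₁ h₁).2 C hC] at hx₁
  exact (hCsub hx₁).resolve_left fun h ↦ h.2 hx₂
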